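/- If Γ is an austere finite simplicial graph with n vertices, then Out(A_Γ) is isomorphic to (ℤ/2ℤ)^n; more precisely, the quotient map Aut(A_Γ) → Out(A_Γ) restricts to an isomorphism from the inversion subgroup I_Γ ≅ (ℤ/2ℤ)^n onto Out(A_Γ). -/

import Mathlib

noncomputable section

/-- The subgroup of inner automorphisms inside `MulAut G`. -/
def Inn (G : Type) [Group G] : Subgroup (MulAut G) :=
  (MulAut.conj : G →* MulAut G).range

instance Inn.normal (G : Type) [Group G] : (Inn G).Normal := by
  constructor
  rintro x ⟨g, rfl⟩ φ
  refine ⟨φ g, ?_⟩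
  ext h
  simp [MulAut.mul_apply, MulAut.conj_apply, map_mul, map_inv]

/-- The outer automorphism group of `G`. -/
abbrev Out (G : Type) [Group G] := MulAut G ⧸ Inn G

/-- The set of commutator relators defining the RAAG of a graph. -/
def raagRels {V : Type} (G : SimpleGraph V) : Set (FreeGroup V) :=
  {r | ∃ u v : V, G.Adj u v ∧
    r = FreeGroup.of u * FreeGroup.of v * (FreeGroup.of u)⁻¹ * (FreeGroup.of v)⁻¹}

/-- The right-angled Artin group of a graph. -/
abbrev RAAG {V : Type} (G : SimpleGraph V) := PresentedGroup (raagRels G)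

/-- The standard generator of `RAAG G` corresponding to a vertex. -/
def gen {V : Type} (G : SimpleGraph V) (v : V) : RAAG G := PresentedGroup.of v

/-- The star of a vertex: the vertex together with its neighbours. -/
def star {V : Type} (G : SimpleGraph V) (v : V) : Set V := insert v (G.neighborSet v)

/-- `u` dominates `v` if `lk(v) ⊆ st(u)`. -/
def Dominates {V : Type} (G : SimpleGraph V) (u v : V) : Prop :=
  G.neighborSet v ⊆ star G u

/-- A graph has trivial automorphism group. -/
def TrivialAut {V : Type} (G : SimpleGraph V) : Prop := ∀ e : G ≃g G, ∀ v, e v = v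

/-- A graph is focused at a vertex `c`. -/
def Focused {V : Type} (G : SimpleGraph V) (c : V) : Prop :=
  (∀ u v : V, u ≠ v → Dominates G u v → u = c) ∧
  ∀ v : V, v ≠ c → (G.induce (star G v)ᶜ).Connected

/-- A graph is austere. -/
def Austere {V : Type} (G : SimpleGraph V) : Prop :=
  TrivialAut G ∧ (∀ u v : V, u ≠ v → ¬Dominates G u v) ∧
  ∀ v : V, (G.induce (star G v)ᶜ).Connected

/-- `P` is (the vertex set of) a connected component of the induced subgraph on `s`. -/
def IsCompOf {V : Type} (G : SimpleGraph V) (s : Set V) (P : Set V) : Prop :=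
  ∃ x : s, P = Subtype.val '' {y : s | (G.induce s).Reachable x y}

/-- `φ` is the inversion at the vertex `v`. -/
def IsInversion {V : Type} (G : SimpleGraph V) (φ : MulAut (RAAG G)) (v : V) : Prop :=
  φ (gen G v) = (gen G v)⁻¹ ∧ ∀ w : V, w ≠ v → φ (gen G w) = gen G w

/-- `φ` is the transvection `τ_{uv}` (`v ↦ uv`). -/
def IsTransvection {V : Type} (G : SimpleGraph V) (φ : MulAut (RAAG G)) (u v : V) : Prop :=
  u ≠ v ∧ Dominates G u v ∧ φ (gen G v) = gen G u * gen G v ∧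
    ∀ w : V, w ≠ v → φ (gen G w) = gen G w

/-- `φ` is the partial conjugation `χ_{v,P}`. -/
def IsPartialConj {V : Type} (G : SimpleGraph V) (φ : MulAut (RAAG G)) (v : V) (P : Set V) :
    Prop :=
  IsCompOf G (star G v)ᶜ P ∧ (∀ u ∈ P, φ (gen G u) = gen G v * gen G u * (gen G v)⁻¹) ∧
    ∀ w : V, w ∉ P → φ (gen G w) = gen G w

/-- The subgroup `I_Γ` of `Aut(A_Γ)` generated by the inversions. -/
def InvSubgroup {V : Type} (G : SimpleGraph V) : Subgroup (MulAut (RAAG G)) :=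
  Subgroup.closure {φ | ∃ v, IsInversion G φ v}

/-- The subgroup `PCT` of `Aut(A_Γ)` generated by transvections and partial conjugations. -/
def PCT {V : Type} (G : SimpleGraph V) : Subgroup (MulAut (RAAG G)) :=
  Subgroup.closure {φ | (∃ u v, IsTransvection G φ u v) ∨ ∃ v P, IsPartialConj G φ v P}

/-- The number `l` of vertices dominated by but not adjacent to `c`. -/
def lInv {V : Type} (G : SimpleGraph V) (c : V) : ℕ :=
  Nat.card {v : V | v ≠ c ∧ Dominates G c v ∧ ¬G.Adj c v}

/-- The number `m` of vertices (other than `c`) dominated by `c`. -/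
def mInv {V : Type} (G : SimpleGraph V) (c : V) : ℕ :=
  Nat.card {v : V | v ≠ c ∧ Dominates G c v}

/-- The number `k` of connected components of `Γ \ st(c)`. -/
def kInv {V : Type} (G : SimpleGraph V) (c : V) : ℕ :=
  Nat.card ((G.induce (star G c)ᶜ).ConnectedComponent)

/-- `GL_n(ℤ)`. -/
abbrev GLZ (n : ℕ) := Matrix.GeneralLinearGroup (Fin n) ℤ

/-- `PGL_n(ℤ)`, the quotient of `GL_n(ℤ)` by its centre `{±I}`. -/
abbrev PGLZ (n : ℕ) := GLZ n ⧸ Subgroup.center (GLZ n)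

/-- The principal level 2 congruence subgroup `Λ_l[2]` of `GL_l(ℤ)`. -/
def congr2 (l : ℕ) : Subgroup (GLZ l) :=
  (Matrix.GeneralLinearGroup.map (Int.castRingHom (ZMod 2)) :
    GLZ l →* Matrix.GeneralLinearGroup (Fin l) (ZMod 2)).ker

/-- The matrix `(1 1 / 0 -1)`. -/
def Bmat : Matrix (Fin 2) (Fin 2) ℤ := !![1, 1; 0, -1]

/-- A block-diagonal `2l × 2l` matrix whose `i`th `2 × 2` diagonal block is
`Bmat` if `ε i` and the identity otherwise. -/
def Lmat (l : ℕ) (ε : Fin l → Bool) : Matrix (Fin l × Fin 2) (Fin l × Fin 2) ℤ :=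
  fun a b =>
    if a.1 = b.1 then (if ε a.1 then Bmat a.2 b.2 else (1 : Matrix (Fin 2) (Fin 2) ℤ) a.2 b.2)
    else 0

/-- `GL_{2l}(ℤ)`, with rows and columns indexed by `Fin l × Fin 2`. -/
abbrev GL2l (l : ℕ) := Matrix.GeneralLinearGroup (Fin l × Fin 2) ℤ

/-- The subgroup `𝓛 ≤ GL_{2l}(ℤ)`. -/
def scriptL (l : ℕ) : Subgroup (GL2l l) :=
  Subgroup.closure {M : GL2l l |
    ∃ ε : Fin l → Bool, (M : Matrix (Fin l × Fin 2) (Fin l × Fin 2) ℤ) = Lmat l ε}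

/-- The index type realizing the block decomposition `d = 2l + p + q`. -/
abbrev BIdx (l p q : ℕ) := (Fin l × Fin 2) ⊕ (Fin p ⊕ Fin q)

/-- The block-diagonal matrix `Diag(D₁, D₂, ε·I_q)` with `D₁ ∈ 𝓛` given by `ε1`,
`D₂` diagonal with entries `d2`, and `ε = e`. -/
def Dmat (l p q : ℕ) (ε1 : Fin l → Bool) (d2 : Fin p → ℤˣ) (e : ℤˣ) :
    Matrix (BIdx l p q) (BIdx l p q) ℤ := fun a b =>
  match a, b with
  | Sum.inl a, Sum.inl b => Lmat l ε1 a b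
  | Sum.inr (Sum.inl i), Sum.inr (Sum.inl j) => if i = j then (d2 i : ℤ) else 0
  | Sum.inr (Sum.inr i), Sum.inr (Sum.inr j) => if i = j then (e : ℤ) else 0
  | _, _ => 0

/-- The subgroup `D ≤ GL_d(ℤ)` generated by `−I_d` and the block-diagonal matrices
`Diag(D₁, D₂, ε·I_q)`. -/
def DSub (l p q : ℕ) : Subgroup (Matrix.GeneralLinearGroup (BIdx l p q) ℤ) :=
  Subgroup.closure
    ({M | (M : Matrix (BIdx l p q) (BIdx l p q) ℤ) = -1} ∪
     {M | ∃ ε1 d2 e, (M : Matrix (BIdx l p q) (BIdx l p q) ℤ) = Dmat l p q ε1 d2 e})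

namespace RAAG

variable {V : Type} {G : SimpleGraph V}

/-- The universal property of a right-angled Artin group. -/
def lift {H : Type} [Group H] (f : V → H) (hf : ∀ u v, G.Adj u v → f u * f v = f v * f u) :
    RAAG G →* H :=
  PresentedGroup.toGroup (f := f) (by
    rintro r ⟨u, v, h, rfl⟩
    simp [hf u v h])

@[simp]
theorem lift_gen {H : Type} [Group H] (f : V → H)
    (hf : ∀ u v, G.Adj u v → f u * f v = f v * f u) (v : V) :
    lift f hf (gen G v) = f v :=
  PresentedGroup.toGroup.of _

theorem hom_ext {H : Type} [Group H] {f g : RAAG G →* H}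
    (h : ∀ v, f (gen G v) = g (gen G v)) : f = g :=
  PresentedGroup.ext h

theorem gen_mul_comm {u v : V} (h : G.Adj u v) : gen G u * gen G v = gen G v * gen G u := by
  have h1 : (QuotientGroup.mk (FreeGroup.of u * FreeGroup.of v * (FreeGroup.of u)⁻¹ *
      (FreeGroup.of v)⁻¹) : RAAG G) = 1 :=
    PresentedGroup.one_of_mem ⟨u, v, h, rfl⟩
  have h2 : gen G u * gen G v * (gen G u)⁻¹ * (gen G v)⁻¹ = 1 := h1
  rw [mul_inv_eq_one, mul_inv_eq_iff_eq_mul] at h2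
  exact h2

/-- The standard parabolic subgroup generated by a set of vertices. -/
def par (G : SimpleGraph V) (S : Set V) : Subgroup (RAAG G) :=
  Subgroup.closure (gen G '' S)

theorem gen_mem_par {S : Set V} {v : V} (h : v ∈ S) : gen G v ∈ par G S :=
  Subgroup.subset_closure ⟨v, h, rfl⟩

theorem par_univ : par G Set.univ = ⊤ := by
  rw [par, Set.image_univ]
  exact PresentedGroup.closure_range_of _

theorem commute_of_mem_par {S : Set V} {x p : RAAG G} (h : ∀ s ∈ S, Commute (gen G s) x)
    (hp : p ∈ par G S) : Commute p x := by
  have : par G S ≤ Subgroup.centralizer {x} := by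
    rw [par, Subgroup.closure_le]
    rintro _ ⟨s, hs, rfl⟩
    rw [SetLike.mem_coe, Subgroup.mem_centralizer_singleton_iff]
    exact h s hs
  exact Subgroup.mem_centralizer_singleton_iff.1 (this hp)

theorem commute_gen_of_mem_link {u : V} {p : RAAG G} (hp : p ∈ par G (G.neighborSet u)) :
    Commute p (gen G u) :=
  commute_of_mem_par (fun _ hs => gen_mul_comm (G.adj_symm hs)) hp

theorem commute_gen_of_mem_star {u : V} {p : RAAG G} (hp : p ∈ par G (star G u)) :
    Commute p (gen G u) := by
  refine commute_of_mem_par (fun s hs => ?_) hp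
  rcases hs with rfl | hs
  · exact Commute.refl _
  · exact gen_mul_comm (G.adj_symm hs)

/-! ### Exponent sums -/

open Classical in
/-- The exponent sum homomorphism at a vertex, written multiplicatively. -/
def expoHom (v : V) : RAAG G →* Multiplicative ℤ :=
  lift (fun w => Multiplicative.ofAdd (if w = v then 1 else 0)) fun _ _ _ => mul_comm _ _

/-- The exponent sum at a vertex. -/
def expo (v : V) (g : RAAG G) : ℤ := Multiplicative.toAdd (expoHom v g)

open Classical in
theorem expo_gen (v w : V) : expo v (gen G w) = if w = v then 1 else 0 := by
  simp [expo, expoHom]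

@[simp]
theorem expo_gen_self (v : V) : expo v (gen G v) = 1 := by simp [expo_gen]

theorem expo_gen_of_ne {v w : V} (h : w ≠ v) : expo v (gen G w) = 0 := by simp [expo_gen, h]

@[simp] theorem expo_one (v : V) : expo v (1 : RAAG G) = 0 := by simp [expo]

@[simp] theorem expo_mul (v : V) (g h : RAAG G) : expo v (g * h) = expo v g + expo v h := by
  simp [expo]

@[simp] theorem expo_inv (v : V) (g : RAAG G) : expo v g⁻¹ = -expo v g := by simp [expo]

@[simp] theorem expo_pow (v : V) (g : RAAG G) (n : ℕ) : expo v (g ^ n) = n * expo v g := by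
  simp [expo]

@[simp] theorem expo_zpow (v : V) (g : RAAG G) (n : ℤ) : expo v (g ^ n) = n * expo v g := by
  simp [expo]

theorem expo_eq_zero_of_mem_par {S : Set V} {v : V} (hv : v ∉ S) {p : RAAG G}
    (hp : p ∈ par G S) : expo v p = 0 := by
  have : par G S ≤ (expoHom v).ker := by
    rw [par, Subgroup.closure_le]
    rintro _ ⟨s, hs, rfl⟩
    have : s ≠ v := fun h => hv (h ▸ hs)
    simpa [MonoidHom.mem_ker, expo] using expo_gen_of_ne (G := G) this
  have := this hp
  rw [MonoidHom.mem_ker] at this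
  simp [expo, this]

/-! ### Words -/

/-- The group element of a letter, which is a vertex with a sign. -/
def letter (G : SimpleGraph V) (s : V × Bool) : RAAG G :=
  if s.2 then gen G s.1 else (gen G s.1)⁻¹

/-- The inverse letter. -/
def flip (s : V × Bool) : V × Bool := (s.1, !s.2)

@[simp] theorem flip_fst (s : V × Bool) : (flip s).1 = s.1 := rfl

theorem flip_ne (s : V × Bool) : flip s ≠ s := by
  intro h
  have := congrArg Prod.snd h
  simp [flip] at this

@[simp] theorem letter_flip (s : V × Bool) : letter G (flip s) = (letter G s)⁻¹ := by
  obtain ⟨v, _ | _⟩ := s <;> simp [letter, flip]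

theorem letter_mem_par {S : Set V} {s : V × Bool} (h : s.1 ∈ S) : letter G s ∈ par G S := by
  obtain ⟨v, _ | _⟩ := s
  · simpa [letter] using gen_mem_par h
  · simpa [letter] using gen_mem_par h

theorem commute_letter_of_mem_link {s : V × Bool} {p : RAAG G}
    (hp : p ∈ par G (G.neighborSet s.1)) : p * letter G s = letter G s * p := by
  have := commute_gen_of_mem_link hp
  unfold letter
  split_ifs
  · exact this
  · exact this.inv_right

/-- The value of a word. -/
def val (G : SimpleGraph V) (w : List (V × Bool)) : RAAG G := (w.map (letter G)).prod

@[simp] theorem val_nil : val G [] = 1 := rfl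

@[simp] theorem val_cons (s : V × Bool) (w : List (V × Bool)) :
    val G (s :: w) = letter G s * val G w := by simp [val]

@[simp] theorem val_append (w w' : List (V × Bool)) : val G (w ++ w') = val G w * val G w' := by
  simp [val]

theorem val_mem_par {S : Set V} {w : List (V × Bool)} (h : ∀ s ∈ w, s.1 ∈ S) :
    val G w ∈ par G S := by
  refine Subgroup.list_prod_mem _ fun x hx => ?_
  obtain ⟨s, hs, rfl⟩ := List.mem_map.1 hx
  exact letter_mem_par (h s hs)

theorem exists_word_of_mem_par {S : Set V} {g : RAAG G} (h : g ∈ par G S) :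
    ∃ w : List (V × Bool), val G w = g ∧ ∀ s ∈ w, s.1 ∈ S := by
  induction h using Subgroup.closure_induction_right with
  | one => exact ⟨[], by simp⟩
  | mul_right x hx y hy ih =>
    obtain ⟨v, hv, rfl⟩ := hy
    obtain ⟨w, rfl, hw⟩ := ih
    refine ⟨w ++ [(v, true)], by simp [letter], ?_⟩
    intro s hs
    rcases List.mem_append.1 hs with hs | hs
    · exact hw s hs
    · rw [List.mem_singleton.1 hs]; exact hv
  | mul_inv_cancel x hx y hy ih =>
    obtain ⟨v, hv, rfl⟩ := hy
    obtain ⟨w, rfl, hw⟩ := ih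
    refine ⟨w ++ [(v, false)], by simp [letter], ?_⟩
    intro s hs
    rcases List.mem_append.1 hs with hs | hs
    · exact hw s hs
    · rw [List.mem_singleton.1 hs]; exact hv

theorem exists_word (g : RAAG G) : ∃ w : List (V × Bool), val G w = g := by
  obtain ⟨w, hw, -⟩ := exists_word_of_mem_par (S := Set.univ) (g := g) (by simp [par_univ])
  exact ⟨w, hw⟩

@[elab_as_elim]
theorem induction_right {p : RAAG G → Prop} (g : RAAG G) (one : p 1)
    (mul_gen : ∀ g v, p g → p (g * gen G v))
    (mul_gen_inv : ∀ g v, p g → p (g * (gen G v)⁻¹)) : p g := by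
  obtain ⟨w, rfl⟩ := exists_word g
  induction w using List.reverseRecOn with
  | nil => exact one
  | append_singleton w s ih =>
    obtain ⟨v, _ | _⟩ := s
    · simpa [letter] using mul_gen_inv _ v ih
    · simpa [letter] using mul_gen _ v ih

theorem exists_min_length {p : List (V × Bool) → Prop} (h : ∃ w, p w) :
    ∃ w, p w ∧ ∀ w', p w' → w.length ≤ w'.length := by
  obtain ⟨w, hw⟩ := h
  induction hn : w.length using Nat.strong_induction_on generalizing w with
  | _ n ih =>
    by_cases hmin : ∀ w', p w' → w.length ≤ w'.length
    · exact ⟨w, hw, hmin⟩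
    · push Not at hmin
      obtain ⟨w', hw', hlt⟩ := hmin
      exact ih _ (hn ▸ hlt) w' hw' rfl

/-! ### Walls -/

open Classical in
/-- Right multiplication by a generator, recording the crossings of the wall of type `u`
through the identity. -/
def stepPerm (u v : V) : Equiv.Perm (RAAG G × Bool) where
  toFun p := (p.1 * gen G v, xor p.2 (decide (v = u ∧ p.1 ∈ par G (G.neighborSet u))))
  invFun p := (p.1 * (gen G v)⁻¹,
    xor p.2 (decide (v = u ∧ p.1 * (gen G v)⁻¹ ∈ par G (G.neighborSet u))))
  left_inv p := by simp
  right_inv p := by simp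

theorem stepPerm_comm (u : V) {v w : V} (h : G.Adj v w) :
    stepPerm (G := G) u v * stepPerm u w = stepPerm u w * stepPerm u v := by
  classical
  have key : ∀ x y : V, G.Adj x y → ∀ g : RAAG G,
      (x = u ∧ g * gen G y ∈ par G (G.neighborSet u)) ↔
        (x = u ∧ g ∈ par G (G.neighborSet u)) := by
    rintro x y hxy g
    refine and_congr_right ?_
    rintro rfl
    exact Subgroup.mul_mem_cancel_right _ (gen_mem_par hxy)
  ext p
  · simp [stepPerm, mul_assoc, gen_mul_comm h]
  · simp only [stepPerm, Equiv.Perm.coe_mul, Function.comp, Equiv.coe_fn_mk]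
    rw [Bool.xor_assoc, Bool.xor_assoc, Bool.xor_comm (decide _), decide_eq_decide.2 (key v w h _),
      decide_eq_decide.2 (key w v h.symm _)]

/-- The right action of the group on pairs recording wall crossings. -/
def stepHom (u : V) : RAAG G →* (Equiv.Perm (RAAG G × Bool))ᵐᵒᵖ :=
  lift (fun v => MulOpposite.op (stepPerm u v)) fun _ _ h => by
    rw [← MulOpposite.op_mul, ← MulOpposite.op_mul, stepPerm_comm u h]

/-- The side of the wall of type `u` through the identity on which a group element lies; the
identity is on the side `false` and the generator `u` is on the side `true`. -/
def side (u : V) (g : RAAG G) : Bool := ((stepHom u g).unop (1, false)).2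

theorem stepHom_fst (u : V) (g : RAAG G) : ((stepHom u g).unop (1, false)).1 = g := by
  induction g using induction_right with
  | one => simp
  | mul_gen g v ih => simp [stepHom, stepPerm] at ih ⊢; exact ih
  | mul_gen_inv g v ih =>
    have h : (stepHom u (g * (gen G v)⁻¹)).unop (1, false) =
        (stepPerm u v).symm ((stepHom u g).unop (1, false)) := by
      simp [stepHom]
    rw [h, stepPerm, Equiv.coe_fn_symm_mk, ih]

@[simp] theorem side_one (u : V) : side u (1 : RAAG G) = false := by simp [side]

open Classical in
theorem side_mul_gen (u v : V) (g : RAAG G) : side u (g * gen G v) =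
    xor (side u g) (decide (v = u ∧ g ∈ par G (G.neighborSet u))) := by
  have h := stepHom_fst u g
  have h2 : (stepHom u (g * gen G v)).unop (1, false) =
      stepPerm u v ((stepHom u g).unop (1, false)) := by
    simp [stepHom]
  rw [side, h2, stepPerm]
  simp [h, side]

theorem side_mul_gen_of_ne {u v : V} (h : v ≠ u) (g : RAAG G) :
    side u (g * gen G v) = side u g := by simp [side_mul_gen, h]

theorem side_mul_letter_of_ne {u : V} {s : V × Bool} (h : s.1 ≠ u) (g : RAAG G) :
    side u (g * letter G s) = side u g := by
  obtain ⟨v, _ | _⟩ := s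
  · have := side_mul_gen_of_ne h (g * (gen G v)⁻¹)
    simpa [letter] using this.symm
  · simpa [letter] using side_mul_gen_of_ne h g

theorem side_mul_of_mem_par {u : V} {S : Set V} (hu : u ∉ S) (g : RAAG G) {k : RAAG G}
    (hk : k ∈ par G S) : side u (g * k) = side u g := by
  obtain ⟨w, rfl, hw⟩ := exists_word_of_mem_par hk
  clear hk
  induction w generalizing g with
  | nil => simp
  | cons s w ih =>
    rw [val_cons, ← mul_assoc, ih _ fun t ht => hw t (List.mem_cons_of_mem _ ht)]
    exact side_mul_letter_of_ne (by rintro rfl; exact hu (hw s List.mem_cons_self)) g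

theorem side_of_mem_link {u : V} {p : RAAG G} (hp : p ∈ par G (G.neighborSet u)) :
    side u p = false := by
  simpa using side_mul_of_mem_par (G.notMem_neighborSet_self) 1 hp

theorem side_mul_left {u : V} {p : RAAG G} (hp : p ∈ par G (G.neighborSet u)) (g : RAAG G) :
    side u (p * g) = side u g := by
  have key : ∀ g v, side u (p * g) = side u g ↔
      side u (p * (g * gen G v)) = side u (g * gen G v) := by
    intro g v
    rw [← mul_assoc, side_mul_gen, side_mul_gen, Subgroup.mul_mem_cancel_left _ hp]
    simp
  induction g using induction_right with
  | one => simp [side_of_mem_link hp]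
  | mul_gen g v ih => exact (key g v).1 ih
  | mul_gen_inv g v ih => exact (key (g * (gen G v)⁻¹) v).2 (by simpa using ih)

theorem side_cross {u : V} {s : V × Bool} {g : RAAG G}
    (h : side u g ≠ side u (g * letter G s)) :
    s = (u, !side u g) ∧
      (if side u g then g * (gen G u)⁻¹ else g) ∈ par G (G.neighborSet u) := by
  obtain ⟨v, _ | _⟩ := s
  · set k := g * (gen G v)⁻¹ with hk
    have hg : g = k * gen G v := by simp [hk]
    have h1 : side u (k * gen G v) ≠ side u k := by simpa [letter, hk] using h
    rw [side_mul_gen] at h1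
    have h2 : v = u ∧ k ∈ par G (G.neighborSet u) := by
      by_contra hcon
      simp [hcon] at h1
    obtain ⟨rfl, h3⟩ := h2
    have h4 : side v g = true := by rw [hg, side_mul_gen, side_of_mem_link h3]; simp [h3]
    simp only [h4, if_true]
    exact ⟨rfl, h3⟩
  · have h1 : side u (g * gen G v) ≠ side u g := by simpa [letter] using h.symm
    rw [side_mul_gen] at h1
    have h2 : v = u ∧ g ∈ par G (G.neighborSet u) := by
      by_contra hcon
      simp [hcon] at h1
    obtain ⟨rfl, h3⟩ := h2
    simp [side_of_mem_link h3, h3]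

theorem side_cross_cross {u : V} {s t : V × Bool} {g h : RAAG G}
    (hg : side u g ≠ side u (g * letter G s)) (hh : side u h ≠ side u (h * letter G t))
    (hgh : side u g = side u h) : s = t ∧ g⁻¹ * h ∈ par G (G.neighborSet u) := by
  obtain ⟨rfl, h1⟩ := side_cross hg
  obtain ⟨rfl, h2⟩ := side_cross hh
  refine ⟨by rw [hgh], ?_⟩
  rw [← hgh] at h2
  split_ifs at h1 h2
  · have h3 := mul_mem (inv_mem h1) h2
    have h4 := commute_gen_of_mem_link h3
    have h5 : g⁻¹ * h = (gen G u)⁻¹ *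
        ((g * (gen G u)⁻¹)⁻¹ * (h * (gen G u)⁻¹) * gen G u) := by group
    rw [h5, h4.eq, inv_mul_cancel_left]
    exact h3
  · exact mul_mem (inv_mem h1) h2

theorem exists_cross {u : V} {g : RAAG G} {w : List (V × Bool)}
    (h : side u g ≠ side u (g * val G w)) :
    ∃ a s b, w = a ++ s :: b ∧ side u (g * val G a) = side u g ∧
      side u (g * val G a * letter G s) ≠ side u g := by
  induction w generalizing g with
  | nil => simp at h
  | cons s w ih =>
    by_cases hs : side u (g * letter G s) = side u g
    · rw [val_cons, ← mul_assoc, ← hs] at h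
      obtain ⟨a, t, b, rfl, h1, h2⟩ := ih h
      refine ⟨s :: a, t, b, rfl, ?_, ?_⟩
      · rw [val_cons, ← mul_assoc, h1, hs]
      · rw [val_cons, ← mul_assoc, ← hs]; exact h2
    · exact ⟨[], s, w, rfl, by simp, by simpa using hs⟩

/-- Every edge of the Cayley graph crosses a wall. -/
theorem exists_wall (g : RAAG G) (s : V × Bool) :
    ∃ c : RAAG G, side s.1 (c⁻¹ * g) ≠ side s.1 (c⁻¹ * (g * letter G s)) := by
  have h1 : side s.1 (gen G s.1) = true := by
    have := side_mul_gen s.1 s.1 (1 : RAAG G)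
    simpa using this
  obtain ⟨v, _ | _⟩ := s
  · exact ⟨g * (gen G v)⁻¹, by simpa [letter] using h1⟩
  · exact ⟨g, by simpa [letter] using h1⟩

/-! ### Reduced words -/

/-- A word is reduced if no two of its letters cancel. -/
def Reduced (G : SimpleGraph V) (w : List (V × Bool)) : Prop :=
  ∀ a s b d, w = a ++ s :: (b ++ flip s :: d) → val G b ∉ par G (G.neighborSet s.1)

theorem val_cancel {s : V × Bool} {b : List (V × Bool)}
    (h : val G b ∈ par G (G.neighborSet s.1)) (a d : List (V × Bool)) :
    val G (a ++ s :: (b ++ flip s :: d)) = val G (a ++ (b ++ d)) := by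
  have := commute_letter_of_mem_link h
  simp only [val_append, val_cons, letter_flip]
  rw [← mul_assoc (letter G s), ← this]
  group

theorem Reduced.of_min_length {p : RAAG G → Prop} {w : List (V × Bool)} (hw : p (val G w))
    (hmin : ∀ w', p (val G w') → w.length ≤ w'.length) : Reduced G w := by
  rintro a s b d rfl hb
  rw [val_cancel hb] at hw
  have := hmin _ hw
  simp at this

theorem Reduced.side_eq {a b : List (V × Bool)} {s : V × Bool} (hr : Reduced G (a ++ s :: b))
    {g : RAAG G}
    (h : side s.1 (g * val G a) ≠ side s.1 (g * val G a * letter G s)) :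
    side s.1 g = side s.1 (g * val G a) ∧
      side s.1 (g * val G a * letter G s) = side s.1 (g * val G (a ++ s :: b)) := by
  constructor
  · by_contra hne
    obtain ⟨a1, t, a2, rfl, h1, h2⟩ := exists_cross hne
    have h3 : side s.1 (g * val G a1 * letter G t) = side s.1 (g * val G (a1 ++ t :: a2)) := by
      cases h4 : side s.1 g <;> simp_all
    obtain ⟨h5, h6⟩ := side_cross_cross (s := flip t) (g := g * val G a1 * letter G t)
      (by simpa [h1] using h2) h h3
    refine hr a1 t a2 b (by rw [h5]; simp) ?_
    have h7 : t.1 = s.1 := by rw [← h5]; rfl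
    rw [h7]
    simpa [mul_assoc] using h6
  · by_contra hne
    have h0 : g * val G (a ++ s :: b) = g * val G a * letter G s * val G b := by
      simp [mul_assoc]
    rw [h0] at hne
    obtain ⟨b1, t, b2, rfl, h1, h2⟩ := exists_cross hne
    obtain ⟨h5, h6⟩ := side_cross_cross (s := flip s) (t := t)
      (g := g * val G a * letter G s) (h := g * val G a * letter G s * val G b1)
      (by simpa using h.symm) (by rw [h1]; exact h2.symm) h1.symm
    refine hr a s b1 b2 (by rw [h5]) ?_
    simpa [mul_assoc] using h6

/-- Letters of a reduced word of an element of a parabolic subgroup lie in that subgroup. -/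
theorem Reduced.mem_of_mem_par {w : List (V × Bool)} (hr : Reduced G w) {S : Set V}
    (hw : val G w ∈ par G S) {s : V × Bool} (hs : s ∈ w) : s.1 ∈ S := by
  obtain ⟨a, b, rfl⟩ := List.append_of_mem hs
  obtain ⟨c, hc⟩ := exists_wall (val G a) s
  rw [← mul_assoc] at hc
  obtain ⟨h1, h2⟩ := hr.side_eq hc
  by_contra hS
  have h3 := side_mul_of_mem_par hS c⁻¹ hw
  rw [← h2, h1] at h3
  exact hc h3.symm

/-- The first letter of a shortest path to a coset of a parabolic subgroup, and more generally
every wall crossed by such a path, separates the starting point from the coset. -/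
theorem gate {p k : RAAG G} {S : Set V} {w : List (V × Bool)}
    (hw : k⁻¹ * (p * val G w) ∈ par G S)
    (hmin : ∀ w', k⁻¹ * (p * val G w') ∈ par G S → w.length ≤ w'.length)
    {u : V} {c : RAAG G} (h : side u (c⁻¹ * p) ≠ side u (c⁻¹ * (p * val G w)))
    {y : RAAG G} (hy : k⁻¹ * y ∈ par G S) :
    side u (c⁻¹ * y) = side u (c⁻¹ * (p * val G w)) := by
  by_contra hne
  rw [← mul_assoc] at h
  obtain ⟨a, s, b, rfl, h1, h2⟩ := exists_cross h
  set z := p * val G (a ++ s :: b) with hz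
  have hzy : z⁻¹ * y ∈ par G S := by
    have := mul_mem (inv_mem hw) hy
    simpa [mul_assoc] using this
  obtain ⟨m, hm, hmS⟩ := exists_word_of_mem_par hzy
  have h3 : side u (c⁻¹ * z) ≠ side u (c⁻¹ * z * val G m) := by
    rw [hm]; simpa [mul_assoc] using Ne.symm hne
  obtain ⟨m1, t, m2, rfl, h4, h5⟩ := exists_cross h3
  have h6 : side u (c⁻¹ * p * val G a * letter G s) = side u (c⁻¹ * z * val G m1) := by
    rw [h4]
    rw [mul_assoc c⁻¹ p, ← hz] at h
    revert h h2
    generalize side u (c⁻¹ * p * val G a * letter G s) = b1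
    generalize side u (c⁻¹ * z) = b2
    generalize side u (c⁻¹ * p) = b3
    cases b1 <;> cases b2 <;> cases b3 <;> simp
  obtain ⟨h7, h8⟩ := side_cross_cross (s := flip s) (t := t)
    (by simpa [h1] using h2) (by rw [h4]; exact h5.symm) h6
  have hs : s.1 = u := by
    have := (side_cross (by rw [h1]; exact h2.symm :
      side u (c⁻¹ * p * val G a) ≠ side u (c⁻¹ * p * val G a * letter G s))).1
    rw [this]
  have ht : t.1 ∈ S := hmS t (by simp)
  have hsS : s.1 ∈ S := by rw [← h7] at ht; exact ht
  have h9 : val G b * val G m1 ∈ par G (G.neighborSet s.1) := by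
    rw [hs]
    simpa [hz, mul_assoc] using h8
  have h10 := commute_letter_of_mem_link h9
  have h11 : p * val G (a ++ b) = z * (val G m1 * (letter G s)⁻¹ * (val G m1)⁻¹) := by
    have : z * val G m1 = p * val G a * (letter G s * (val G b * val G m1)) := by
      simp [hz, mul_assoc]
    rw [← mul_assoc, ← mul_assoc, this, ← h10]
    simp [mul_assoc]
  have hm1 : val G m1 ∈ par G S := val_mem_par fun x hx => hmS x (by simp [hx])
  have := hmin (a ++ b) (by
    rw [h11, ← mul_assoc]
    exact mul_mem hw (mul_mem (mul_mem hm1 (inv_mem (letter_mem_par hsS))) (inv_mem hm1)))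
  simp at this

theorem gate_head {p k : RAAG G} {S : Set V} {s : V × Bool} {w : List (V × Bool)}
    (hw : k⁻¹ * (p * val G (s :: w)) ∈ par G S)
    (hmin : ∀ w', k⁻¹ * (p * val G w') ∈ par G S → (s :: w).length ≤ w'.length)
    {c : RAAG G} (h : side s.1 (c⁻¹ * p) ≠ side s.1 (c⁻¹ * (p * letter G s)))
    {y : RAAG G} (hy : k⁻¹ * y ∈ par G S) :
    side s.1 (c⁻¹ * y) = side s.1 (c⁻¹ * (p * letter G s)) := by
  have hr : Reduced G ([] ++ s :: w) :=
    Reduced.of_min_length (p := fun x => k⁻¹ * (p * x) ∈ par G S) hw hmin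
  have h1 := (hr.side_eq (g := c⁻¹ * p) (by simpa [mul_assoc] using h)).2
  rw [val_nil, mul_one, List.nil_append, mul_assoc, mul_assoc] at h1
  rw [gate hw hmin (h1 ▸ h) hy, h1]

theorem exists_min_path (p k : RAAG G) (S : Set V) :
    ∃ w, k⁻¹ * (p * val G w) ∈ par G S ∧
      ∀ w', k⁻¹ * (p * val G w') ∈ par G S → w.length ≤ w'.length := by
  refine exists_min_length (p := fun w => k⁻¹ * (p * val G w) ∈ par G S) ?_
  obtain ⟨w, hw⟩ := exists_word (p⁻¹ * k)
  exact ⟨w, by simp [hw]⟩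

/-! ### The action on walls -/

/-- The walls of type `u`. -/
abbrev Wall (G : SimpleGraph V) (u : V) := RAAG G ⧸ par G (G.neighborSet u)

/-- The side of a wall on which a group element lies. -/
def wside {u : V} (H : Wall G u) (g : RAAG G) : Bool := side u (H.out⁻¹ * g)

theorem wside_mk {u : V} (c g : RAAG G) :
    wside (QuotientGroup.mk c : Wall G u) g = side u (c⁻¹ * g) := by
  obtain ⟨p, hp⟩ := QuotientGroup.mk_out_eq_mul (par G (G.neighborSet u)) c
  rw [wside, hp, mul_inv_rev, mul_assoc, side_mul_left (inv_mem p.2)]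

theorem wside_smul {u : V} (k : RAAG G) (H : Wall G u) (g : RAAG G) :
    wside (k • H) g = wside H (k⁻¹ * g) := by
  induction H using QuotientGroup.induction_on with
  | H c =>
    rw [MulAction.Quotient.smul_mk, wside_mk, wside_mk]
    simp [mul_assoc]

theorem wside_mul_of_mem_par {u : V} {S : Set V} (hu : u ∉ S) (H : Wall G u) (g : RAAG G)
    {k : RAAG G} (hk : k ∈ par G S) : wside H (g * k) = wside H g := by
  rw [wside, ← mul_assoc, side_mul_of_mem_par hu _ hk, wside]

/-- The set of walls of type `u` separating two group elements is finite. -/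
theorem finite_separating (u : V) (p q : RAAG G) :
    {H : Wall G u | wside H p ≠ wside H q}.Finite := by
  obtain ⟨w, hw⟩ := exists_word (p⁻¹ * q)
  obtain rfl : q = p * val G w := by simp [hw]
  clear hw
  induction w generalizing p with
  | nil => simp
  | cons s w ih =>
    refine Set.Finite.subset ((Set.toFinite {(QuotientGroup.mk p : Wall G u),
      QuotientGroup.mk (p * (gen G u)⁻¹)}).union (ih (p * letter G s))) ?_
    intro H hH
    by_cases h : wside H p = wside H (p * letter G s)
    · right
      simpa [← h, mul_assoc] using hH
    · left
      induction H using QuotientGroup.induction_on with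
      | H c =>
        rw [wside_mk, wside_mk, ← mul_assoc] at h
        have := (side_cross h).2
        split_ifs at this
        · right
          rw [mul_assoc] at this
          exact QuotientGroup.eq.2 this
        · left
          exact QuotientGroup.eq.2 this

theorem expo_eq_zero_of_smul_eq {u v : V} (hv : v ∉ G.neighborSet u) {H : Wall G u}
    {k : RAAG G} (h : k • H = H) : expo v k = 0 := by
  induction H using QuotientGroup.induction_on with
  | H c =>
    rw [MulAction.Quotient.smul_mk] at h
    have := expo_eq_zero_of_mem_par hv (QuotientGroup.eq.1 h)
    simpa using this

theorem exists_pow_smul_eq {X : Type} [MulAction (RAAG G) X] {D : Set X} (hD : D.Finite)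
    {k : RAAG G} (hk : ∀ H ∈ D, k • H ∈ D) {H : X} (hH : H ∈ D) :
    ∃ n : ℕ, 0 < n ∧ k ^ n • H = H := by
  have hpow : ∀ n : ℕ, k ^ n • H ∈ D := by
    intro n
    induction n with
    | zero => simpa using hH
    | succ n ih => rw [pow_succ', mul_smul]; exact hk _ ih
  have : Finite D := hD
  obtain ⟨i, j, hij, h⟩ :=
    Finite.exists_ne_map_eq_of_infinite (fun n : ℕ => (⟨k ^ n • H, hpow n⟩ : D))
  have h' : k ^ i • H = k ^ j • H := congrArg Subtype.val h
  wlog hlt : i < j generalizing i j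
  · exact this j i hij.symm h.symm h'.symm (by omega)
  refine ⟨j - i, by omega, ?_⟩
  have hj : j = i + (j - i) := by omega
  rw [hj, pow_add, mul_smul] at h'
  exact (MulAction.injective _ h').symm

/-- If a coset of a parabolic subgroup is invariant under the generator `v`, then it meets the
parabolic subgroup of the star of `v`. -/
theorem exists_mem_star {v : V} {S : Set V} {k : RAAG G} (h : k⁻¹ * gen G v * k ∈ par G S) :
    ∃ q ∈ par G (star G v), k⁻¹ * q ∈ par G S := by
  obtain ⟨w, hw, hmin⟩ := exists_min_path 1 k S
  have hr : Reduced G w :=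
    Reduced.of_min_length (p := fun x => k⁻¹ * (1 * x) ∈ par G S) hw hmin
  refine ⟨val G w, val_mem_par fun s hs => ?_, by simpa using hw⟩
  by_cases hsv : s.1 = v
  · exact Or.inl hsv
  right
  obtain ⟨a, b, rfl⟩ := List.append_of_mem hs
  obtain ⟨c, hc⟩ := exists_wall (val G a) s
  rw [← mul_assoc] at hc
  obtain ⟨h1, h2⟩ := hr.side_eq hc
  have h3 : side s.1 (c⁻¹ * 1) ≠ side s.1 (c⁻¹ * (1 * val G (a ++ s :: b))) := by
    rw [one_mul, ← h2, mul_one, h1]; exact hc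
  let D : Set (Wall G s.1) := {H | ∀ y, k⁻¹ * y ∈ par G S → wside H 1 ≠ wside H y}
  have hD : D.Finite := (finite_separating s.1 1 k).subset fun H hH => hH k (by simp)
  have hcD : (QuotientGroup.mk c : Wall G s.1) ∈ D := by
    intro y hy
    rw [wside_mk, wside_mk, gate hw hmin h3 hy]
    exact h3
  have hinv : ∀ H ∈ D, gen G v • H ∈ D := by
    intro H hH y hy
    rw [wside_smul, wside_smul]
    have h4 : wside H ((gen G v)⁻¹ * 1) = wside H 1 := by
      rw [mul_one, ← one_mul (gen G v)⁻¹]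
      exact wside_mul_of_mem_par (S := {v}) hsv H 1 (inv_mem (gen_mem_par rfl))
    rw [h4]
    apply hH
    have := mul_mem (inv_mem h) hy
    simpa [mul_assoc] using this
  obtain ⟨n, hn, hfix⟩ := exists_pow_smul_eq hD hinv hcD
  by_contra hlk
  have := expo_eq_zero_of_smul_eq (v := v) (fun hmem => hlk (G.adj_symm hmem)) hfix
  simp at this
  omega

/-- The centralizer of a generator is generated by its star. -/
theorem mem_star_of_commute {v : V} {k : RAAG G} (h : Commute k (gen G v)) :
    k ∈ par G (star G v) := by
  have h1 : k⁻¹ * gen G v * k ∈ par G {v} := by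
    rw [mul_assoc, ← h.eq, inv_mul_cancel_left]
    exact gen_mem_par rfl
  obtain ⟨q, hq, hkq⟩ := exists_mem_star h1
  have h2 : par G {v} ≤ par G (star G v) :=
    Subgroup.closure_mono (Set.image_mono (by rintro _ rfl; exact Or.inl rfl))
  have := mul_mem hq (inv_mem (h2 hkq))
  simpa using this

theorem exists_common_of_commute {v w : V} {c d : RAAG G}
    (h : Commute (c * gen G v * c⁻¹) (d * gen G w * d⁻¹)) :
    ∃ p, c⁻¹ * p ∈ par G (star G v) ∧ d⁻¹ * p ∈ par G (star G w) := by
  have h1 : Commute ((c⁻¹ * d)⁻¹ * gen G v * (c⁻¹ * d)) (gen G w) := by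
    have := h.map (MulAut.conj d⁻¹)
    simpa [mul_assoc] using this
  obtain ⟨q, hq, hkq⟩ := exists_mem_star (mem_star_of_commute h1)
  exact ⟨c * q, by simpa using hq, by simpa [mul_assoc] using hkq⟩

/-! ### Cosets of stars in an austere graph -/

theorem mem_star_comm {u v : V} : u ∈ star G v ↔ v ∈ star G u := by
  simp only [_root_.star, Set.mem_insert_iff, SimpleGraph.mem_neighborSet, G.adj_comm u v,
    eq_comm (a := u)]

variable {c : V → RAAG G}

theorem exists_side (hA : Austere G)
    (hc : ∀ v w, G.Adj v w →
      ∃ p, (c v)⁻¹ * p ∈ par G (star G v) ∧ (c w)⁻¹ * p ∈ par G (star G w))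
    {x : V} (h : RAAG G) :
    ∃ b, ∀ v, ∃ y, (c v)⁻¹ * y ∈ par G (star G v) ∧ side x (h⁻¹ * y) = b := by
  have hconst : ∀ {z : V} (k : RAAG G) {v}, z ∉ star G v → ∀ {y y'},
      (c v)⁻¹ * y ∈ par G (star G v) → (c v)⁻¹ * y' ∈ par G (star G v) →
        side z (k⁻¹ * y) = side z (k⁻¹ * y') := by
    intro z k v hv y y' hy hy'
    have h1 := mul_mem (inv_mem hy) hy'
    have h2 := side_mul_of_mem_par hv (k⁻¹ * y) h1
    simpa [mul_assoc] using h2.symm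
  have hself : ∀ v, (c v)⁻¹ * c v ∈ par G (star G v) := fun v => by simp
  obtain ⟨-, hdom, hconn⟩ := hA
  obtain ⟨⟨v₀, hv₀⟩⟩ := (hconn x).nonempty
  have hfar : ∀ v, v ∉ star G x → side x (h⁻¹ * c v) = side x (h⁻¹ * c v₀) := by
    intro v hv
    obtain ⟨p⟩ := (hconn x).preconnected ⟨v, hv⟩ ⟨v₀, hv₀⟩
    change side x (h⁻¹ * c (⟨v, hv⟩ : ↥(star G x)ᶜ).1) =
      side x (h⁻¹ * c (⟨v₀, hv₀⟩ : ↥(star G x)ᶜ).1)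
    generalize (⟨v, hv⟩ : ↥(star G x)ᶜ) = a at p ⊢
    generalize (⟨v₀, hv₀⟩ : ↥(star G x)ᶜ) = b at p ⊢
    induction p with
    | nil => rfl
    | @cons u w z hadj p ih =>
      rw [← ih]
      obtain ⟨q, hq1, hq2⟩ := hc u w hadj
      rw [hconst h (fun hx => u.2 (mem_star_comm.1 hx)) (hself u) hq1,
        hconst h (fun hx => w.2 (mem_star_comm.1 hx)) (hself w) hq2]
  refine ⟨side x (h⁻¹ * c v₀), ?_⟩
  have hlink : ∀ v, v ≠ x → ∃ y, (c v)⁻¹ * y ∈ par G (star G v) ∧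
      side x (h⁻¹ * y) = side x (h⁻¹ * c v₀) := by
    intro v hvx
    by_cases hv : v ∈ star G x
    · obtain ⟨u, huv, hux⟩ := Set.not_subset.1 (hdom x v hvx.symm)
      obtain ⟨q, hq1, hq2⟩ := hc v u huv
      refine ⟨q, hq1, ?_⟩
      rw [← hfar u hux]
      exact hconst h (fun hx => hux (mem_star_comm.1 hx)) hq2 (hself u)
    · exact ⟨c v, hself v, hfar v hv⟩
  intro v
  by_cases hvx : v = x
  swap
  · exact hlink v hvx
  subst hvx
  by_contra hcon
  push Not at hcon
  obtain ⟨w, ⟨z, hz, hzw⟩, hmin⟩ := exists_min_length (p := fun w => ∃ z,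
    h⁻¹ * z ∈ par G (star G v) ∧ (c v)⁻¹ * (z * val G w) ∈ par G (star G v)) (by
      obtain ⟨w, hw⟩ := exists_word (h⁻¹ * c v)
      exact ⟨w, h, by simp, by simp [hw]⟩)
  have hgv : gen G v ∈ par G (star G v) := gen_mem_par (Or.inl rfl)
  rcases w with _ | ⟨s, w⟩
  · have h1 : (c v)⁻¹ * h ∈ par G (star G v) := by
      have := mul_mem hzw (inv_mem hz)
      simpa [mul_assoc] using this
    have h2 := hcon h h1
    have h3 := hcon (h * gen G v) (by rw [← mul_assoc]; exact mul_mem h1 hgv)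
    have h4 : side v (gen G v) = true := by
      have := side_mul_gen v v (1 : RAAG G)
      simpa using this
    simp only [inv_mul_cancel, side_one, inv_mul_cancel_left, h4] at h2 h3
    revert h2 h3
    cases side v (h⁻¹ * c v₀) <;> simp
  have hs : s.1 ∉ star G v := by
    intro hs
    have := hmin w ⟨z * letter G s, ?_, ?_⟩
    · simp at this
    · rw [← mul_assoc]; exact mul_mem hz (letter_mem_par hs)
    · simpa [mul_assoc] using hzw
  obtain ⟨k, hk⟩ := exists_wall z s
  have hY := fun y (hy : (c v)⁻¹ * y ∈ par G (star G v)) =>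
    gate_head hzw (fun w' hw' => hmin w' ⟨z, hz, hw'⟩) hk hy
  refine hdom s.1 v (fun hsv => hs (Or.inl hsv)) fun u hu => ?_
  rw [mem_star_comm]
  by_contra hsu
  obtain ⟨y₁, hy₁u, hy₁v⟩ := hc u v (G.adj_symm hu)
  obtain ⟨y₂, hy₂, hb⟩ := hlink u (G.ne_of_adj (G.adj_symm hu))
  obtain ⟨m, hm, hmS⟩ := exists_word_of_mem_par (mul_mem (inv_mem hy₁u) hy₂)
  have hm' : y₂ = y₁ * val G m := by simp [hm]
  have h5 : side v (h⁻¹ * y₁) ≠ side v (h⁻¹ * y₁ * val G m) := by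
    rw [mul_assoc, ← hm', hb]
    exact hcon y₁ hy₁v
  obtain ⟨m₁, t, m₂, rfl, h6, h7⟩ := exists_cross h5
  have h8 := (side_cross (h6.trans_ne h7.symm)).2
  have hle : par G (G.neighborSet v) ≤ par G (star G v) :=
    Subgroup.closure_mono (Set.image_mono (Set.subset_insert _ _))
  have h9 : h⁻¹ * (y₁ * val G m₁) ∈ par G (star G v) := by
    rw [← mul_assoc]
    split_ifs at h8
    · have := mul_mem (hle h8) hgv
      simpa using this
    · exact hle h8
  have h10 : (c u)⁻¹ * (y₁ * val G m₁) ∈ par G (star G u) := by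
    rw [← mul_assoc]
    exact mul_mem hy₁u (val_mem_par fun r hr => hmS r (by simp [hr]))
  have h11 := hconst k hsu hy₁u h10
  rw [hY y₁ hy₁v] at h11
  have h12 := side_mul_of_mem_par hs (k⁻¹ * z) (mul_mem (inv_mem hz) h9)
  have h13 : k⁻¹ * z * ((h⁻¹ * z)⁻¹ * (h⁻¹ * (y₁ * val G m₁))) = k⁻¹ * (y₁ * val G m₁) := by
    group
  rw [h13, ← h11] at h12
  exact hk h12.symm

/-- In an austere graph, a family of cosets of stars in which adjacent members meet has a common
element. -/
theorem exists_common [Fintype V] (hA : Austere G)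
    (hc : ∀ v w, G.Adj v w →
      ∃ p, (c v)⁻¹ * p ∈ par G (star G v) ∧ (c w)⁻¹ * p ∈ par G (star G w)) :
    ∃ g, ∀ v, (c v)⁻¹ * g ∈ par G (star G v) := by
  let D : RAAG G → ∀ (v x : V), Set (Wall G x) := fun g v x =>
    {H | ∀ y, (c v)⁻¹ * y ∈ par G (star G v) → wside H g ≠ wside H y}
  have hD : ∀ g v x, (D g v x).Finite := fun g v x =>
    (finite_separating x g (c v)).subset fun H hH => hH (c v) (by simp)
  let N : RAAG G → ℕ := fun g => ∑ v, ∑ x, (D g v x).ncard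
  obtain ⟨g, hg⟩ : ∃ g, ∀ g', N g ≤ N g' :=
    ⟨Function.argmin N, fun g' => Function.argmin_le N g'⟩
  refine ⟨g, fun v => ?_⟩
  by_contra hgv
  obtain ⟨w, hw, hmin⟩ := exists_min_path g (c v) (star G v)
  rcases w with _ | ⟨s, w⟩
  · exact hgv (by simpa using hw)
  have hsub : ∀ v' x, D (g * letter G s) v' x ⊆ D g v' x := by
    intro v' x H hH
    by_cases h : wside H g = wside H (g * letter G s)
    · intro y hy
      rw [h]
      exact hH y hy
    exfalso
    induction H using QuotientGroup.induction_on with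
    | H k =>
      rw [wside_mk, wside_mk] at h
      obtain rfl : s.1 = x := by
        rw [← mul_assoc] at h
        rw [(side_cross h).1]
      obtain ⟨b, hb⟩ := exists_side hA hc (x := s.1) k
      obtain ⟨y, hy, hyb⟩ := hb v
      obtain ⟨y', hy', hyb'⟩ := hb v'
      rw [gate_head hw hmin h hy] at hyb
      refine hH y' hy' ?_
      rw [wside_mk, wside_mk, hyb, hyb']
  obtain ⟨k, hk⟩ := exists_wall g s
  have hlt : (D (g * letter G s) v s.1).ncard < (D g v s.1).ncard := by
    refine Set.ncard_lt_ncard ⟨hsub v s.1, fun hcon => ?_⟩ (hD g v s.1)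
    have h1 : (QuotientGroup.mk k : Wall G s.1) ∈ D g v s.1 := by
      intro y hy
      rw [wside_mk, wside_mk, gate_head hw hmin hk hy]
      exact hk
    refine hcon h1 _ hw ?_
    rw [wside_mk, wside_mk, gate_head hw hmin hk hw]
  refine (hg (g * letter G s)).not_gt ?_
  have hle : ∀ v' x, (D (g * letter G s) v' x).ncard ≤ (D g v' x).ncard := fun v' x =>
    Set.ncard_le_ncard (hsub v' x) (hD g v' x)
  exact Finset.sum_lt_sum (fun v' _ => Finset.sum_le_sum fun x _ => hle v' x)
    ⟨v, Finset.mem_univ _, Finset.sum_lt_sum (fun x _ => hle v x) ⟨s.1, Finset.mem_univ _, hlt⟩⟩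

/-! ### Axes -/

/-- Powers of a word which is shortest in its conjugacy class are reduced. -/
theorem reduced_flatten_replicate {w : List (V × Bool)}
    (hmin : ∀ w', IsConj (val G w) (val G w') → w.length ≤ w'.length) (k : ℕ) :
    Reduced G (List.replicate k w).flatten := by
  suffices H : ∀ n, ∀ b : List (V × Bool), b.length = n → ∀ a s d,
      (List.replicate k w).flatten = a ++ s :: (b ++ flip s :: d) →
        val G b ∉ par G (G.neighborSet s.1) from
    fun a s b d h => H _ b rfl a s d h
  intro n
  induction n using Nat.strong_induction_on with
  | _ n ih =>
  rintro b rfl a s d hW hb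
  have hr : Reduced G b := by
    rintro a' t b' d' rfl
    exact ih b'.length (by simp; omega) b' rfl (a ++ s :: a') t (d' ++ flip s :: d)
      (by rw [hW]; simp)
  set Y := s :: (b ++ flip s :: d) with hY
  have hcomm : ∀ k, w ++ (List.replicate k w).flatten = (List.replicate k w).flatten ++ w := by
    intro k
    induction k with
    | zero => simp
    | succ k ih => rw [List.replicate_succ, List.flatten_cons, List.append_assoc, ← ih]
  have hYw : (w ++ a) ++ Y = a ++ (Y ++ w) := by
    rw [List.append_assoc, ← hW, hcomm, hW, List.append_assoc]
  have hwa : ∃ r, w ++ a = a ++ r ∧ Y ++ w = r ++ Y := by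
    rcases List.append_eq_append_iff.1 hYw with ⟨r, h1, h2⟩ | ⟨r, h1, h2⟩
    · have h3 := congrArg List.length h1
      simp at h3
      have h4 : w = [] := List.eq_nil_of_length_eq_zero (by omega)
      subst h4
      exact ⟨[], by simp⟩
    · exact ⟨r, h1, h2⟩
  obtain ⟨r, h1, h2⟩ := hwa
  have hlen : r.length = w.length := by
    have := congrArg List.length h1
    simp at this
    omega
  have hconj : IsConj (val G w) (val G r) := by
    have h3 := congrArg (val G) h1
    rw [val_append, val_append] at h3
    rw [isConj_iff]
    exact ⟨(val G a)⁻¹, by rw [inv_inv, mul_assoc, h3, inv_mul_cancel_left]⟩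
  have hlong : ∀ e, r ≠ (s :: (b ++ [flip s])) ++ e := by
    rintro e rfl
    have h4 := val_cancel hb [] e
    have h5 : s :: (b ++ [flip s]) ++ e = [] ++ s :: (b ++ flip s :: e) := by simp
    rw [h5, h4] at hconj
    have := hmin _ hconj
    simp at hlen this
    omega
  have h3 : (s :: (b ++ [flip s])) ++ (d ++ w) = r ++ Y := by rw [← h2, hY]; simp
  rcases List.append_eq_append_iff.1 h3 with ⟨e, h4, -⟩ | ⟨e, h4, h5⟩
  · exact hlong e h4
  · rcases e with _ | ⟨t, e⟩
    · exact hlong [] (by simpa using h4.symm)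
    rcases r with _ | ⟨r₀, r⟩
    · have h6 : w = [] := List.eq_nil_of_length_eq_zero (by simpa using hlen.symm)
      subst h6
      simp at hW
    simp only [hY, List.cons_append, List.cons.injEq] at h4 h5
    obtain ⟨rfl, -⟩ := h5
    have h6 : s ∈ b ++ [flip s] := by rw [h4.2]; simp
    rcases List.mem_append.1 h6 with h7 | h7
    · exact G.notMem_neighborSet_self (hr.mem_of_mem_par hb h7)
    · exact flip_ne s (List.mem_singleton.1 h7).symm

/-- A wall is skewered by `g` if it separates all large positive powers of `g` from all large
negative powers. -/
def Skewered (g : RAAG G) {u : V} (H : Wall G u) : Prop :=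
  ∃ (b : Bool) (N : ℕ), ∀ n : ℤ, N ≤ n → wside H (g ^ n) = b ∧ wside H (g ^ (-n)) = !b

theorem val_flatten_replicate (w : List (V × Bool)) (k : ℕ) :
    val G (List.replicate k w).flatten = val G w ^ k := by
  induction k with
  | zero => simp
  | succ k ih => rw [List.replicate_succ, List.flatten_cons, val_append, ih, pow_succ']

theorem exists_skewered {w : List (V × Bool)}
    (hmin : ∀ w', IsConj (val G w) (val G w') → w.length ≤ w'.length) {s : V × Bool}
    (hs : s ∈ w) : ∃ H : Wall G s.1, Skewered (val G w) H := by
  obtain ⟨a, b, hw⟩ := List.append_of_mem hs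
  obtain ⟨c, hc⟩ := exists_wall (val G a) s
  refine ⟨QuotientGroup.mk c, side s.1 (c⁻¹ * (val G a * letter G s)), 1, fun n hn => ?_⟩
  obtain ⟨m, rfl⟩ : ∃ m : ℕ, n = m + 1 := ⟨(n - 1).toNat, by omega⟩
  have hrep : (List.replicate (m + 1 + 1 + m) w).flatten =
      ((List.replicate (m + 1) w).flatten ++ a) ++ s :: (b ++ (List.replicate m w).flatten) := by
    rw [List.replicate_add, List.replicate_succ' (n := m + 1)]
    simp [hw]
  have hr := reduced_flatten_replicate hmin (m + 1 + 1 + m)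
  rw [hrep] at hr
  have h0 : c⁻¹ * (val G w ^ (m + 1))⁻¹ * val G ((List.replicate (m + 1) w).flatten ++ a) =
      c⁻¹ * val G a := by
    rw [val_append, val_flatten_replicate]
    group
  obtain ⟨h1, h2⟩ := hr.side_eq (g := c⁻¹ * (val G w ^ (m + 1))⁻¹) (by
    rw [h0, mul_assoc]; exact hc)
  rw [h0] at h1 h2
  have h4 : (val G w ^ (m + 1))⁻¹ * val G w ^ (m + 1 + 1 + m) = val G w ^ (m + 1) := by
    rw [show m + 1 + 1 + m = (m + 1) + (m + 1) by omega, pow_add _ (m + 1),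
      inv_mul_cancel_left]
  rw [← hrep, val_flatten_replicate, mul_assoc c⁻¹ (_⁻¹), h4, mul_assoc] at h2
  rw [wside_mk, wside_mk, h2]
  refine ⟨by norm_cast, ?_⟩
  have h3 : c⁻¹ * val G w ^ (-((m : ℤ) + 1)) = c⁻¹ * (val G w ^ (m + 1))⁻¹ := by
    rw [zpow_neg]; norm_cast
  rw [h3, h1, ← h2]
  revert hc
  cases side s.1 (c⁻¹ * val G a) <;> cases side s.1 (c⁻¹ * (val G a * letter G s)) <;> simp

variable {g h : RAAG G} {u : V} {H : Wall G u}

theorem wside_zpow_mul (n : ℤ) (x : RAAG G) :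
    wside H (g ^ n * x) = wside (g ^ (-n) • H) x := by
  rw [wside_smul, zpow_neg, inv_inv]

theorem Skewered.injective (hH : Skewered g H) :
    Function.Injective fun n : ℤ => g ^ n • H := by
  intro i j hij
  by_contra hne
  have hfix : g ^ (i - j) • H = H := by
    have : g ^ i • H = g ^ j • H := hij
    rw [sub_eq_neg_add, zpow_add, mul_smul, this, ← mul_smul, ← zpow_add]
    simp
  have hconst : ∀ n : ℤ, wside H (g ^ ((i - j) * n)) = wside H 1 := by
    intro n
    rw [← mul_one (g ^ _), wside_zpow_mul, ← mul_neg, zpow_mul]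
    congr 1
    exact Subgroup.zpow_mem (MulAction.stabilizer (RAAG G) H) hfix (-n)
  obtain ⟨b, N, hN⟩ := hH
  have hpos : 1 ≤ (i - j) * (i - j) := by
    have : 0 < (i - j) * (i - j) := mul_self_pos.2 (sub_ne_zero.2 hne)
    omega
  obtain ⟨h1, h2⟩ := hN ((i - j) * ((i - j) * N)) (by
    rw [← mul_assoc]; nlinarith [Int.natCast_nonneg N])
  rw [hconst] at h1
  rw [← mul_neg, hconst, h1] at h2
  simp at h2

theorem Skewered.smul (hH : Skewered g H) (hh : Commute h g) : Skewered g (h • H) := by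
  have hfin : {n : ℤ | wside H (g ^ n) ≠ wside H (g ^ n * h⁻¹)}.Finite := by
    have hinj : Function.Injective fun n : ℤ => g ^ (-n) • H :=
      hH.injective.comp neg_injective
    refine ((finite_separating u 1 h⁻¹).preimage hinj.injOn).subset fun n hn => ?_
    have h1 : wside H (g ^ n * 1) ≠ wside H (g ^ n * h⁻¹) := by simpa using hn
    rwa [wside_zpow_mul, wside_zpow_mul] at h1
  obtain ⟨M, hM⟩ := (hfin.image Int.natAbs).bddAbove
  have hlarge : ∀ n : ℤ, M < n.natAbs → wside (h • H) (g ^ n) = wside H (g ^ n) := by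
    intro n hn
    rw [wside_smul, (hh.inv_left.zpow_right n).eq]
    by_contra hne
    have := hM ⟨n, Ne.symm hne, rfl⟩
    omega
  obtain ⟨b, N, hN⟩ := hH
  refine ⟨b, N + M + 1, fun n hn => ?_⟩
  push_cast at hn
  rw [hlarge n (by omega), hlarge (-n) (by omega)]
  exact hN n (by omega)

theorem Skewered.exists_zpow_smul_mem (hH : Skewered g H) :
    ∃ n : ℤ, g ^ n • H ∈ {K : Wall G u | wside K 1 ≠ wside K g} := by
  by_contra! hcon
  have hstep : ∀ n : ℤ, wside H (g ^ n) = wside H (g ^ (n + 1)) := by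
    intro n
    have h1 := hcon (-n)
    simp only [Set.mem_ofPred_eq, not_not] at h1
    rwa [← wside_zpow_mul, ← wside_zpow_mul, mul_one, ← zpow_add_one] at h1
  have hconst : ∀ n : ℤ, wside H (g ^ n) = wside H (g ^ (0 : ℤ)) := by
    intro n
    induction n using Int.induction_on with
    | zero => rfl
    | succ n ih => rw [← hstep, ih]
    | pred n ih => rw [hstep, sub_add_cancel, ih]
  obtain ⟨b, N, hN⟩ := hH
  obtain ⟨h1, h2⟩ := hN N le_rfl
  rw [hconst] at h1 h2
  rw [h1] at h2
  simp at h2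

theorem Skewered.expo_eq_zero (hH : Skewered g H) (hh : Commute h g) {s : V}
    (hs : s ∉ G.neighborSet u) (hg : expo s g = 0) : expo s h = 0 := by
  have hpow : ∀ i : ℕ, ∃ n : ℤ,
      g ^ n • h ^ i • H ∈ {K : Wall G u | wside K 1 ≠ wside K g} := fun i =>
    (hH.smul (hh.pow_left i)).exists_zpow_smul_mem
  choose n hn using hpow
  have : Finite {K : Wall G u | wside K 1 ≠ wside K g} := finite_separating u 1 g
  obtain ⟨i, j, hij, heq⟩ := Finite.exists_ne_map_eq_of_infinite
    (fun i : ℕ => (⟨_, hn i⟩ : {K : Wall G u | wside K 1 ≠ wside K g}))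
  have heq' : g ^ n i • h ^ i • H = g ^ n j • h ^ j • H := congrArg Subtype.val heq
  have hfix : ((g ^ n j * h ^ j)⁻¹ * (g ^ n i * h ^ i)) • H = H := by
    rw [mul_smul, mul_smul, heq', ← mul_smul (g ^ n j), inv_smul_smul]
  have h1 := expo_eq_zero_of_smul_eq hs hfix
  simp only [expo_mul, expo_inv, expo_zpow, expo_pow, hg, mul_zero, zero_add] at h1
  have h2 : ((i : ℤ) - j) * expo s h = 0 := by linarith
  rcases mul_eq_zero.1 h2 with h3 | h3
  · omega
  · exact h3

/-- In the absence of domination, an element homologous to a generator `v` whose centralizer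
surjects in homology onto the star of `v` is conjugate to `v`. -/
theorem isConj_gen {v : V} (hdom : ∀ u, u ≠ v → ¬Dominates G u v) (hv : expo v g = 1)
    (hne : ∀ u, u ≠ v → expo u g = 0)
    (hlk : ∀ s ∈ G.neighborSet v, ∃ h, Commute h g ∧ expo s h ≠ 0) :
    ∃ c, g = c * gen G v * c⁻¹ := by
  obtain ⟨w, hw, hmin⟩ := exists_min_length (p := fun w => IsConj g (val G w)) (by
    obtain ⟨w, hw⟩ := exists_word g
    exact ⟨w, by rw [hw]⟩)
  have hmin' : ∀ w', IsConj (val G w) (val G w') → w.length ≤ w'.length := fun w' hw' =>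
    hmin w' (hw.trans hw')
  obtain ⟨k, hk⟩ := isConj_iff.1 hw
  have hexpo : ∀ u, expo u (val G w) = expo u g := fun u => by rw [← hk]; simp
  have hmem : val G w ∈ par G {v} := by
    refine val_mem_par fun s hs => ?_
    by_contra hsv
    obtain ⟨H, hH⟩ := exists_skewered hmin' hs
    refine hdom s.1 hsv fun t ht => ?_
    by_contra hts
    obtain ⟨h, hh, ht0⟩ := hlk t ht
    have h1 : Commute (k * h * k⁻¹) (val G w) := by
      have := hh.map (MulAut.conj k)
      simpa [hk] using this
    have h2 := hH.expo_eq_zero h1 (fun hmem => hts (Or.inr hmem))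
      (by rw [hexpo]; exact hne t (G.ne_of_adj ht).symm)
    exact ht0 (by simpa using h2)
  rw [par, Set.image_singleton, ← Subgroup.zpowers_eq_closure, Subgroup.mem_zpowers_iff] at hmem
  obtain ⟨n, hn⟩ := hmem
  have h1 := hexpo v
  rw [← hn, hv] at h1
  simp only [expo_zpow, expo_gen_self, mul_one] at h1
  rw [h1, zpow_one] at hn
  exact ⟨k⁻¹, by rw [hn, ← hk]; group⟩

/-! ### The action on the abelianization -/

/-- The integral Heisenberg group. -/
@[ext]
structure Heis where
  /-- The first abelian coordinate. -/
  x : ℤ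
  /-- The second abelian coordinate. -/
  y : ℤ
  /-- The central coordinate. -/
  z : ℤ

namespace Heis

instance : Mul Heis := ⟨fun p q => ⟨p.x + q.x, p.y + q.y, p.z + q.z + p.x * q.y⟩⟩

instance : One Heis := ⟨⟨0, 0, 0⟩⟩

instance : Inv Heis := ⟨fun p => ⟨-p.x, -p.y, -p.z + p.x * p.y⟩⟩

@[simp] theorem mul_x (p q : Heis) : (p * q).x = p.x + q.x := rfl
@[simp] theorem mul_y (p q : Heis) : (p * q).y = p.y + q.y := rfl
@[simp] theorem mul_z (p q : Heis) : (p * q).z = p.z + q.z + p.x * q.y := rfl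
@[simp] theorem one_x : (1 : Heis).x = 0 := rfl
@[simp] theorem one_y : (1 : Heis).y = 0 := rfl
@[simp] theorem one_z : (1 : Heis).z = 0 := rfl
@[simp] theorem inv_x (p : Heis) : p⁻¹.x = -p.x := rfl
@[simp] theorem inv_y (p : Heis) : p⁻¹.y = -p.y := rfl
@[simp] theorem inv_z (p : Heis) : p⁻¹.z = -p.z + p.x * p.y := rfl

instance : Group Heis :=
  Group.ofLeftAxioms (fun p q r => by ext <;> simp <;> ring) (fun p => by ext <;> simp)
    (fun p => by ext <;> simp)

end Heis

theorem expo_mul_expo_of_commute {u w : V} (hne : u ≠ w) (hadj : ¬G.Adj u w) {g h : RAAG G}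
    (hgh : Commute g h) : expo u g * expo w h = expo w g * expo u h := by
  classical
  let F : RAAG G →* Heis :=
    lift (fun v => ⟨if v = u then 1 else 0, if v = w then 1 else 0, 0⟩) (by
      intro a b hab
      ext
      · simp [add_comm]
      · simp [add_comm]
      · by_cases h1 : a = u <;> by_cases h2 : b = w <;> by_cases h3 : b = u <;>
          by_cases h4 : a = w <;> simp_all [G.adj_comm])
  have hF : ∀ g, (F g).x = expo u g ∧ (F g).y = expo w g := by
    intro g
    induction g using induction_right with
    | one => simp
    | mul_gen g v ih => simp [F, ih, expo_gen]
    | mul_gen_inv g v ih => simp [F, ih, expo_gen]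
  have h1 := congrArg Heis.z (hgh.map F).eq
  simp only [Heis.mul_z, (hF _).1, (hF _).2] at h1
  linarith

theorem expo_map [Fintype V] (φ : RAAG G →* RAAG G) (u : V) (g : RAAG G) :
    expo u (φ g) = ∑ v, expo v g * expo u (φ (gen G v)) := by
  classical
  induction g using induction_right with
  | one => simp
  | mul_gen g v ih => simp [ih, expo_gen, add_mul, Finset.sum_add_distrib]
  | mul_gen_inv g v ih => simp [ih, expo_gen, add_mul, Finset.sum_add_distrib]

/-- The vectors which satisfy the relations imposed by `expo_mul_expo_of_commute` on the
exponent sums of an element commuting with an element with exponent sums `x`. -/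
def commSpace (G : SimpleGraph V) (x : V → ℚ) : Submodule ℚ (V → ℚ) where
  carrier := {y | ∀ a b, a ≠ b → ¬G.Adj a b → x a * y b = x b * y a}
  add_mem' hy hz a b h h' := by simp [mul_add, hy a b h h', hz a b h h']
  zero_mem' := by simp
  smul_mem' r y hy a b h h' := by
    have := hy a b h h'
    simp only [Pi.smul_apply, smul_eq_mul]
    linear_combination r * this

/-- The restriction of a vector in `commSpace G x` to the star of a vertex. -/
def commRes (G : SimpleGraph V) (x : V → ℚ) (w : V) : commSpace G x →ₗ[ℚ] (star G w → ℚ) :=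
  (LinearMap.funLeft ℚ ℚ Subtype.val).comp (commSpace G x).subtype

theorem commRes_injective {x : V → ℚ} {w : V} (hw : x w ≠ 0) :
    Function.Injective (commRes G x w) := by
  rw [injective_iff_map_eq_zero]
  rintro ⟨y, hy⟩ hy0
  have h0 : ∀ s ∈ star G w, y s = 0 := fun s hs => congrFun hy0 ⟨s, hs⟩
  ext b
  change y b = 0
  by_cases hb : b ∈ star G w
  · exact h0 b hb
  · have h1 := hy w b (fun h => hb (Or.inl h.symm)) (fun h => hb (Or.inr h))
    rw [h0 w (Or.inl rfl), mul_zero] at h1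
    exact (mul_eq_zero.1 h1).resolve_left hw

theorem finrank_commSpace_le [Finite V] {x : V → ℚ} {w : V} (hw : x w ≠ 0) :
    Module.finrank ℚ (commSpace G x) ≤ Nat.card (star G w) := by
  have := Fintype.ofFinite V
  have := Fintype.ofFinite (star G w)
  have h := LinearMap.finrank_le_finrank_of_injective (commRes_injective (G := G) hw)
  rwa [Module.finrank_fintype_fun_eq_card, ← Nat.card_eq_fintype_card] at h

theorem dominates_of_finrank_commSpace [Finite V] {x : V → ℚ} {w u : V} (hw : x w ≠ 0)
    (hfin : Module.finrank ℚ (commSpace G x) = Nat.card (star G w)) (hu : x u ≠ 0) :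
    Dominates G u w := by
  classical
  have := Fintype.ofFinite V
  have := Fintype.ofFinite (star G w)
  have hsurj : Function.Surjective (commRes G x w) := by
    rw [← LinearMap.injective_iff_surjective_of_finrank_eq_finrank]
    · exact commRes_injective hw
    · rw [hfin, Module.finrank_fintype_fun_eq_card, Nat.card_eq_fintype_card]
  intro t ht
  by_contra hts
  have htw : t ∈ star G w := Or.inr ht
  obtain ⟨⟨y, hy⟩, hyt⟩ := hsurj (Pi.single ⟨t, htw⟩ 1)
  have h1 : y t = 1 := by
    have := congrFun hyt ⟨t, htw⟩
    rwa [Pi.single_eq_same] at this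
  have h2 : y w = 0 := by
    have := congrFun hyt ⟨w, Or.inl rfl⟩
    rwa [Pi.single_eq_of_ne] at this
    exact fun h => G.ne_of_adj ht (congrArg Subtype.val h)
  have h3 := hy u t (fun h => hts (Or.inl h.symm)) (fun h => hts (Or.inr h))
  rw [h1, mul_one] at h3
  have h4 : y u ≠ 0 := fun h => hu (by rw [h3, h, mul_zero])
  have h5 : u ≠ w := by
    rintro rfl
    exact h4 h2
  have h6 : ¬G.Adj w u := by
    intro h
    have := congrFun hyt ⟨u, Or.inr h⟩
    rw [Pi.single_eq_of_ne] at this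
    · exact h4 this
    · exact fun h => hts (Or.inl (congrArg Subtype.val h).symm)
  have h7 := hy w u h5.symm h6
  rw [h2, mul_zero] at h7
  exact (mul_ne_zero hw h4) h7

/-- The support of a row of an invertible matrix whose rows satisfy the commutation relations
of a graph consists of vertices dominating a single vertex, and this vertex depends bijectively
on the row. -/
theorem exists_perm_dominates [Fintype V] [DecidableEq V] {M : Matrix V V ℚ} (hdet : M.det ≠ 0)
    (hM : ∀ v, ∀ s ∈ star G v, M s ∈ commSpace G (M v)) :
    ∃ σ : Equiv.Perm V, ∀ v, M v (σ v) ≠ 0 ∧ ∀ u, M v u ≠ 0 → Dominates G u (σ v) := by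
  have hdet' := hdet
  rw [← Matrix.det_transpose, Matrix.det_apply] at hdet'
  obtain ⟨σ, -, hσ⟩ := Finset.exists_ne_zero_of_sum_ne_zero hdet'
  have hσ' : ∀ v, M v (σ v) ≠ 0 := by
    intro v h
    exact hσ (by rw [Finset.prod_eq_zero (Finset.mem_univ v) (by simpa using h), smul_zero])
  have hlow : ∀ v, Nat.card (star G v) ≤ Module.finrank ℚ (commSpace G (M v)) := by
    intro v
    have := Fintype.ofFinite (star G v)
    have hli : LinearIndependent ℚ
        (fun s : star G v => (⟨M s.1, hM v s s.2⟩ : commSpace G (M v))) := by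
      refine LinearIndependent.of_comp (commSpace G (M v)).subtype ?_
      exact (Matrix.linearIndependent_rows_of_det_ne_zero hdet).comp _ Subtype.val_injective
    rw [Nat.card_eq_fintype_card]
    exact hli.fintype_card_le_finrank
  have hle : ∀ v ∈ Finset.univ, Nat.card (star G v) ≤ Nat.card (star G (σ v)) := fun v _ =>
    (hlow v).trans (finrank_commSpace_le (hσ' v))
  have heq := (Finset.sum_eq_sum_iff_of_le hle).1
    (Equiv.sum_comp σ fun v => Nat.card (star G v)).symm
  exact ⟨σ, fun v => ⟨hσ' v, fun u hu => dominates_of_finrank_commSpace (hσ' v)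
    (le_antisymm (finrank_commSpace_le (hσ' v)) ((heq v (Finset.mem_univ v)).symm.trans_le
      (hlow v))) hu⟩⟩

theorem exists_perm_expo [Fintype V] (hdom : ∀ u v, u ≠ v → ¬Dominates G u v)
    (φ : MulAut (RAAG G)) :
    ∃ σ : Equiv.Perm V, ∀ v, expo (σ v) (φ (gen G v)) ≠ 0 ∧
      ∀ u, u ≠ σ v → expo u (φ (gen G v)) = 0 := by
  classical
  let M : MulAut (RAAG G) → Matrix V V ℚ := fun φ v u => (expo u (φ (gen G v)) : ℚ)
  have hmul : M φ * M φ⁻¹ = 1 := by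
    ext v u
    have h := expo_map (φ⁻¹ : MulAut (RAAG G)).toMonoidHom u (φ (gen G v))
    simp only [MulEquiv.toMonoidHom_eq_coe, MonoidHom.coe_coe, MulAut.inv_apply_self,
      expo_gen] at h
    rw [Matrix.mul_apply, Matrix.one_apply]
    simp only [M]
    exact_mod_cast h.symm
  have hdet : (M φ).det ≠ 0 := by
    intro h
    have := congrArg Matrix.det hmul
    simp [h] at this
  obtain ⟨σ, hσ⟩ := exists_perm_dominates (G := G) hdet (by
    intro v s hs a b hab hadj
    have hc : Commute (φ (gen G v)) (φ (gen G s)) := by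
      rcases hs with rfl | hs
      · exact Commute.refl _
      · exact Commute.map (gen_mul_comm hs : Commute _ _) φ
    simp only [M]
    exact_mod_cast expo_mul_expo_of_commute hab hadj hc)
  refine ⟨σ, fun v => ⟨by simpa [M] using (hσ v).1, fun u hu => ?_⟩⟩
  by_contra h
  exact hdom u (σ v) hu ((hσ v).2 u (by simpa [M] using h))

/-- An automorphism of an austere right-angled Artin group acts on the abelianization by a
diagonal matrix of signs. -/
theorem exists_sign [Fintype V] (hA : Austere G) (φ : MulAut (RAAG G)) :
    ∃ ε : V → ℤˣ, ∀ v, expo v (φ (gen G v)) = ε v ∧ ∀ u, u ≠ v → expo u (φ (gen G v)) = 0 := by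
  classical
  obtain ⟨σ, hσ⟩ := exists_perm_expo hA.2.1 φ
  have hadj : ∀ v w, G.Adj v w → G.Adj (σ v) (σ w) := by
    intro v w hvw
    by_contra hn
    have hne : σ v ≠ σ w := fun h => G.ne_of_adj hvw (σ.injective h)
    have h1 := expo_mul_expo_of_commute hne hn
      (Commute.map (gen_mul_comm hvw : Commute _ _) φ)
    rw [(hσ v).2 _ hne.symm, zero_mul] at h1
    exact mul_ne_zero (hσ v).1 (hσ w).1 h1
  have hpow : ∀ n : ℕ, ∀ v w, G.Adj v w → G.Adj ((σ ^ n) v) ((σ ^ n) w) := by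
    intro n
    induction n with
    | zero => simp
    | succ n ih =>
      intro v w h
      rw [pow_succ', Equiv.Perm.mul_apply, Equiv.Perm.mul_apply]
      exact hadj _ _ (ih v w h)
  have hinv : ∀ v w, G.Adj (σ v) (σ w) → G.Adj v w := by
    intro v w h
    have h1 := hpow (orderOf σ - 1) _ _ h
    rw [← Equiv.Perm.mul_apply, ← Equiv.Perm.mul_apply, ← pow_succ,
      Nat.sub_add_cancel (orderOf_pos σ), pow_orderOf_eq_one] at h1
    simpa using h1
  have hid : ∀ v, σ v = v := hA.1 ⟨σ, fun {v w} => ⟨hinv v w, hadj v w⟩⟩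
  have hunit : ∀ v, IsUnit (expo v (φ (gen G v))) := by
    intro v
    have h := expo_map (φ⁻¹ : MulAut (RAAG G)).toMonoidHom v (φ (gen G v))
    simp only [MulEquiv.toMonoidHom_eq_coe, MonoidHom.coe_coe, MulAut.inv_apply_self,
      expo_gen_self] at h
    rw [Finset.sum_eq_single v] at h
    · exact IsUnit.of_mul_eq_one _ h.symm
    · intro w _ hw
      rw [(hσ v).2 w (by rwa [hid]), zero_mul]
    · simp
  choose ε hε using hunit
  exact ⟨ε, fun v => ⟨(hε v).symm, fun u hu => (hσ v).2 u (by rwa [hid])⟩⟩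

/-! ### Inversions -/

/-- The endomorphism which inverts the generators according to a choice of signs. -/
def signEnd (G : SimpleGraph V) (ε : V → ℤˣ) : RAAG G →* RAAG G :=
  lift (fun v => gen G v ^ (ε v : ℤ)) fun _ _ h =>
    (Commute.zpow_zpow (gen_mul_comm h) _ _).eq

theorem signEnd_comp (ε δ : V → ℤˣ) :
    (signEnd G ε).comp (signEnd G δ) = signEnd G (ε * δ) :=
  hom_ext fun v => by simp [signEnd, zpow_mul]

theorem signEnd_one : signEnd G 1 = MonoidHom.id _ :=
  hom_ext fun v => by simp [signEnd]

/-- The product of the inversions prescribed by a choice of signs. -/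
def signAut (G : SimpleGraph V) : (V → ℤˣ) →* MulAut (RAAG G) where
  toFun ε := (signEnd G ε).toMulEquiv (signEnd G ε⁻¹) (by rw [signEnd_comp]; simp [signEnd_one])
    (by rw [signEnd_comp]; simp [signEnd_one])
  map_one' := by
    ext g
    exact DFunLike.congr_fun (signEnd_one (G := G)) g
  map_mul' ε δ := by
    ext g
    exact (DFunLike.congr_fun (signEnd_comp (G := G) ε δ) g).symm

@[simp]
theorem signAut_gen (ε : V → ℤˣ) (v : V) : signAut G ε (gen G v) = gen G v ^ (ε v : ℤ) := by
  change signEnd G ε (gen G v) = _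
  simp [signEnd]

theorem mulAut_ext {φ ψ : MulAut (RAAG G)} (h : ∀ v, φ (gen G v) = ψ (gen G v)) : φ = ψ :=
  MulEquiv.toMonoidHom_injective (hom_ext h)

theorem range_signAut [Finite V] : (signAut G).range = InvSubgroup G := by
  classical
  apply le_antisymm
  · rintro _ ⟨ε, rfl⟩
    refine Subgroup.pi_mem_of_mulSingle_mem (H := (InvSubgroup G).comap (signAut G)) ε fun v => ?_
    rcases Int.units_eq_one_or (ε v) with h | h
    · rw [h, Pi.mulSingle_one]
      exact one_mem _
    · refine Subgroup.subset_closure ⟨v, ?_, fun w hw => ?_⟩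
      · simp [h]
      · simp [hw]
  · rw [InvSubgroup, Subgroup.closure_le]
    rintro φ ⟨v, h1, h2⟩
    refine ⟨Pi.mulSingle v (-1), mulAut_ext fun w => ?_⟩
    by_cases hw : w = v
    · subst hw
      simp [h1]
    · simp [hw, h2 w hw]

theorem eq_one_of_signAut_mem_inn {ε : V → ℤˣ} (h : signAut G ε ∈ Inn (RAAG G)) : ε = 1 := by
  obtain ⟨g, hg⟩ := h
  ext v
  have h1 := congrArg (expo v) (DFunLike.congr_fun hg (gen G v))
  simpa using h1.symm

theorem signAut_injective : Function.Injective (signAut G) := by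
  rw [injective_iff_map_eq_one]
  intro ε h
  exact eq_one_of_signAut_mem_inn (G := G) (h ▸ one_mem _)

theorem mem_inn_of_expo [Fintype V] (hA : Austere G) {ψ : MulAut (RAAG G)}
    (hv : ∀ v, expo v (ψ (gen G v)) = 1) (hne : ∀ v u, u ≠ v → expo u (ψ (gen G v)) = 0) :
    ψ ∈ Inn (RAAG G) := by
  have hconj : ∀ v, ∃ c, ψ (gen G v) = c * gen G v * c⁻¹ := fun v =>
    isConj_gen (fun u => hA.2.1 u v) (hv v) (hne v) fun s hs =>
      ⟨ψ (gen G s), Commute.map (gen_mul_comm (G.adj_symm hs) : Commute _ _) ψ, by simp [hv s]⟩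
  choose c hc using hconj
  obtain ⟨g, hg⟩ := exists_common (c := c) hA fun v w hvw =>
    exists_common_of_commute (by
      rw [← hc, ← hc]
      exact Commute.map (gen_mul_comm hvw : Commute _ _) ψ)
  refine ⟨g, mulAut_ext fun v => ?_⟩
  have h1 := (commute_gen_of_mem_star (hg v)).eq
  rw [MulAut.conj_apply, hc, mul_inv_eq_iff_eq_mul, eq_comm, mul_assoc, mul_assoc, eq_comm,
    ← inv_mul_eq_iff_eq_mul, ← mul_assoc, h1]

theorem exists_signAut_mul_mem_inn [Fintype V] (hA : Austere G) (φ : MulAut (RAAG G)) :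
    ∃ ε, (signAut G ε)⁻¹ * φ ∈ Inn (RAAG G) := by
  obtain ⟨ε, hε⟩ := exists_sign hA φ
  have h : φ * signAut G ε ∈ Inn (RAAG G) := by
    refine mem_inn_of_expo hA (fun v => ?_) fun v u hu => ?_
    · rw [MulAut.mul_apply, signAut_gen, map_zpow, expo_zpow, (hε v).1, ← Units.val_mul,
        Int.units_mul_self, Units.val_one]
    · rw [MulAut.mul_apply, signAut_gen, map_zpow, expo_zpow, (hε v).2 u hu, mul_zero]
  have h2 : signAut G ε * signAut G ε = 1 := by
    rw [← map_mul]
    convert map_one (signAut G)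
    ext v
    simp
  refine ⟨ε, ?_⟩
  rw [inv_eq_of_mul_eq_one_left h2]
  exact (Inn.normal (RAAG G)).mem_comm h

theorem bijective_mk_invSubgroup [Fintype V] (hA : Austere G) :
    Function.Bijective ((QuotientGroup.mk' (Inn (RAAG G))).comp (InvSubgroup G).subtype) := by
  constructor
  · rw [injective_iff_map_eq_one]
    rintro ⟨φ, hφ⟩ h
    obtain ⟨ε, rfl⟩ := range_signAut.symm.le hφ
    have h1 : signAut G ε ∈ Inn (RAAG G) := (QuotientGroup.eq_one_iff _).1 h
    ext1
    simp [eq_one_of_signAut_mem_inn h1]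
  · intro x
    obtain ⟨φ, rfl⟩ := QuotientGroup.mk_surjective x
    obtain ⟨ε, hε⟩ := exists_signAut_mul_mem_inn hA φ
    exact ⟨⟨signAut G ε, range_signAut.le ⟨ε, rfl⟩⟩, QuotientGroup.eq.2 hε⟩

/-- The inversion subgroup is elementary abelian of rank the number of vertices. -/
def invSubgroupEquiv [Finite V] :
    InvSubgroup G ≃* Multiplicative (Fin (Nat.card V) → ZMod 2) :=
  have : Fact (Nat.Prime 2) := ⟨Nat.prime_two⟩
  (MulEquiv.subgroupCongr range_signAut.symm).trans <|
    (MonoidHom.ofInjective signAut_injective).symm.trans <|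
      (MulEquiv.arrowCongr (Finite.equivFin V)
        (mulEquivOfPrimeCardEq (p := 2) (G := ℤˣ) (G' := Multiplicative (ZMod 2))
          (by simp) (by simp))).trans
        (MulEquiv.funMultiplicative _ _).symm

end RAAG

/-- For an austere graph, the quotient map restricts to an isomorphism from
`I_Γ ≅ (ℤ/2)^n` onto `Out(A_Γ)`. -/
theorem stmt13 {V : Type} [Fintype V] (G : SimpleGraph V) (hA : Austere G) :
    Nonempty (Out (RAAG G) ≃* Multiplicative (Fin (Nat.card V) → ZMod 2)) ∧
    Nonempty (InvSubgroup G ≃* Multiplicative (Fin (Nat.card V) → ZMod 2)) ∧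
    Function.Bijective (fun g : InvSubgroup G =>
      QuotientGroup.mk' (Inn (RAAG G)) (g : MulAut (RAAG G))) := by
  let e : InvSubgroup G ≃* Out (RAAG G) := MulEquiv.ofBijective _ (RAAG.bijective_mk_invSubgroup hA)
  exact ⟨⟨e.symm.trans RAAG.invSubgroupEquiv⟩, ⟨RAAG.invSubgroupEquiv⟩,
    RAAG.bijective_mk_invSubgroup hA⟩
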